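/- arXiv:1804.01345 — 8 statements merged into one kernel-verified Lean document; each statement's English description precedes it below -/
import Mathlib

section
/- The category of Giry algebras (Eilenberg–Moore algebras over the Giry monad on measurable spaces) is not equivalent to the category of convex spaces with affine maps: there is no equivalence of categories between them (since any equivalence would in particular yield a fully faithful functor from Giry algebras to convex spaces, which does not exist). -/
namespace Paper

/-- A family of convex combination operations satisfies the axioms of a convex space:
unit law, idempotency, parametric commutativity and deformed parametric associativity. -/
structure IsConvexStruct {A : Type*} (comb : unitInterval → A → A → A) : Prop where
  unit : ∀ x y, comb 0 x y = x
  idem : ∀ r x, comb r x x = x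
  comm : ∀ r x y, comb r x y = comb (unitInterval.symm r) y x
  assoc : ∀ (r s t u : unitInterval), 0 < (s : ℝ) → (t : ℝ) = r + s - r * s →
    (u : ℝ) = (s : ℝ) / (t : ℝ) →
    ∀ x y z, comb s (comb r x y) z = comb t x (comb u y z)

section GiryMonad

open MeasureTheory

/-- The evaluation σ-algebra on the space `G(X)` of probability measures on `X`:
the σ-algebra induced from the σ-algebra on measures generated by the evaluations
`φ ↦ φ K` for `K` measurable. -/
noncomputable instance {X : Type*} [MeasurableSpace X] :
    MeasurableSpace (ProbabilityMeasure X) :=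
  MeasurableSpace.comap ProbabilityMeasure.toMeasure inferInstance

lemma measurable_toMeasure {X : Type*} [MeasurableSpace X] :
    Measurable (ProbabilityMeasure.toMeasure : ProbabilityMeasure X → Measure X) :=
  Measurable.of_comap_le le_rfl

/-- The Dirac measure as a probability measure: the unit of the Giry monad. -/
noncomputable def dirac {X : Type*} [MeasurableSpace X] (x : X) : ProbabilityMeasure X :=
  ⟨Measure.dirac x, inferInstance⟩

/-- Pushforward of a probability measure along a measurable map (the action of the
Giry functor on morphisms): `G(f)(φ) = φ ∘ f⁻¹`. -/
noncomputable def pushforward {X Y : Type*} [MeasurableSpace X] [MeasurableSpace Y]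
    (f : X → Y) (hf : Measurable f) (φ : ProbabilityMeasure X) : ProbabilityMeasure Y :=
  ⟨φ.toMeasure.map f, by
    constructor
    rw [Measure.map_apply hf MeasurableSet.univ]
    simp⟩

/-- The multiplication `μ_X : G(G(X)) → G(X)` of the Giry monad,
`μ_X(Φ)(K) = ∫ ξ(K) dΦ(ξ)`. -/
noncomputable def join {X : Type*} [MeasurableSpace X]
    (Φ : ProbabilityMeasure (ProbabilityMeasure X)) : ProbabilityMeasure X :=
  ⟨(Φ.toMeasure.map ProbabilityMeasure.toMeasure).join, by
    constructor
    rw [Measure.join_apply MeasurableSet.univ,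
      lintegral_map (Measure.measurable_coe MeasurableSet.univ) measurable_toMeasure]
    simp⟩

/-- The convex combination `φ +ᵣ ψ = (1-r)·φ + r·ψ` of two probability measures. -/
noncomputable def pcomb {X : Type*} [MeasurableSpace X] (r : unitInterval)
    (φ ψ : ProbabilityMeasure X) : ProbabilityMeasure X :=
  ⟨ENNReal.ofReal (1 - (r : ℝ)) • φ.toMeasure + ENNReal.ofReal (r : ℝ) • ψ.toMeasure, by
    constructor
    simp only [Measure.coe_add, Measure.coe_smul, Pi.add_apply, Pi.smul_apply,
      measure_univ, smul_eq_mul, mul_one]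
    rw [← ENNReal.ofReal_add (by linarith [r.2.2]) r.2.1]
    norm_num⟩

lemma integral_mem_unitInterval {X : Type*} [MeasurableSpace X] (φ : ProbabilityMeasure X)
    (f : X → ℝ) (h0 : ∀ x, 0 ≤ f x) (h1 : ∀ x, f x ≤ 1) :
    ∫ x, f x ∂φ.toMeasure ∈ unitInterval := by
  refine ⟨integral_nonneg h0, ?_⟩
  have h := integral_mono_of_nonneg (μ := φ.toMeasure) (f := f) (g := fun _ => (1 : ℝ))
    (Filter.Eventually.of_forall h0) (integrable_const 1) (Filter.Eventually.of_forall h1)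
  simpa using h

/-- The structure map `E : G(I) → I`, `E(ω) = ∫ x dω`, of the Giry algebra `(I, E)`. -/
noncomputable def Eop (ω : ProbabilityMeasure unitInterval) : unitInterval :=
  ⟨∫ x, (x : ℝ) ∂ω.toMeasure,
    integral_mem_unitInterval ω _ (fun x => x.2.1) (fun x => x.2.2)⟩

/-- The structure map `E_M : G(I^M) → I^M`, `E_M(φ)(m) = ∫ ev_m dφ`. -/
noncomputable def EM (M : Type*) (φ : ProbabilityMeasure (M → unitInterval)) :
    M → unitInterval :=
  fun m => ⟨∫ α, (α m : ℝ) ∂φ.toMeasure,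
    integral_mem_unitInterval φ _ (fun α => (α m).2.1) (fun α => (α m).2.2)⟩

end GiryMonad

open CategoryTheory

/-- An Eilenberg–Moore algebra over the Giry monad: a measurable space `carrier`
together with a measurable structure map `str : G(carrier) → carrier` satisfying
`str(δ_x) = x` and `str ∘ G(str) = str ∘ μ`. -/
structure GiryAlg : Type 1 where
  carrier : Type
  [meas : MeasurableSpace carrier]
  str : MeasureTheory.ProbabilityMeasure carrier → carrier
  measurable_str : Measurable str
  str_dirac : ∀ x, str (dirac x) = x
  str_join : ∀ Φ : MeasureTheory.ProbabilityMeasure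
      (MeasureTheory.ProbabilityMeasure carrier),
    str (pushforward str measurable_str Φ) = str (join Φ)

attribute [instance] GiryAlg.meas

/-- Morphisms of Giry algebras: measurable maps commuting with the structure maps,
`f ∘ κ = λ ∘ G(f)`. -/
def GiryHom (A B : GiryAlg) : Type :=
  {f : A.carrier → B.carrier //
    ∃ hf : Measurable f, ∀ φ, f (A.str φ) = B.str (pushforward f hf φ)}

section PushforwardLemmas

open MeasureTheory

lemma pushforward_id {X : Type*} [MeasurableSpace X] (φ : ProbabilityMeasure X) :
    pushforward id measurable_id φ = φ := by
  apply Subtype.ext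
  simp [pushforward]

lemma pushforward_comp {X Y Z : Type*} [MeasurableSpace X] [MeasurableSpace Y]
    [MeasurableSpace Z] {f : X → Y} {g : Y → Z} (hf : Measurable f) (hg : Measurable g)
    (φ : ProbabilityMeasure X) :
    pushforward (g ∘ f) (hg.comp hf) φ = pushforward g hg (pushforward f hf φ) := by
  apply Subtype.ext
  simp [pushforward, Measure.map_map hg hf]

end PushforwardLemmas

/-- The category of Giry algebras. -/
noncomputable instance : Category GiryAlg where
  Hom := GiryHom
  id A := ⟨id, measurable_id, fun φ => by rw [pushforward_id]; rfl⟩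
  comp {A B C} f g := ⟨g.1 ∘ f.1, by
    obtain ⟨hf, hf'⟩ := f.2
    obtain ⟨hg, hg'⟩ := g.2
    exact ⟨hg.comp hf, fun φ => by
      simp only [Function.comp_apply, hf', hg', pushforward_comp hf hg]⟩⟩
  id_comp f := rfl
  comp_id f := rfl
  assoc f g h := rfl

/-- A convex space: a set with convex combination operations satisfying the axioms. -/
structure CvxCat : Type 1 where
  carrier : Type
  comb : unitInterval → carrier → carrier → carrier
  is_convex : IsConvexStruct comb

/-- The category of convex spaces with affine maps. -/
noncomputable instance : Category CvxCat where
  Hom A B := {f : A.carrier → B.carrier //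
    ∀ (r : unitInterval) (x y : A.carrier), f (A.comb r x y) = B.comb r (f x) (f y)}
  id A := ⟨id, fun _ _ _ => rfl⟩
  comp {A B C} f g := ⟨g.1 ∘ f.1, fun r x y => by
    simp only [Function.comp_apply, f.2, g.2]⟩
  id_comp f := rfl
  comp_id f := rfl
  assoc f g h := rfl

namespace CvxCat

open Limits

/-- A subset closed under convex combinations, as a convex space. -/
def sub (A : CvxCat) (S : Set A.carrier)
    (hS : ∀ r, ∀ x ∈ S, ∀ y ∈ S, A.comb r x y ∈ S) : CvxCat where
  carrier := S
  comb r x y := ⟨A.comb r x y, hS r x x.2 y y.2⟩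
  is_convex :=
    { unit := fun _ _ => Subtype.ext (A.is_convex.unit _ _)
      idem := fun _ _ => Subtype.ext (A.is_convex.idem _ _)
      comm := fun _ _ _ => Subtype.ext (A.is_convex.comm _ _ _)
      assoc := fun r s t u h₀ h₁ h₂ _ _ _ =>
        Subtype.ext (A.is_convex.assoc r s t u h₀ h₁ h₂ _ _ _) }

/-- The inclusion of a convex subset. -/
def subInclusion (A : CvxCat) (S : Set A.carrier)
    (hS : ∀ r, ∀ x ∈ S, ∀ y ∈ S, A.comb r x y ∈ S) : A.sub S hS ⟶ A :=
  ⟨Subtype.val, fun _ _ _ => rfl⟩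

/-- The constant affine map. -/
def constHom (A B : CvxCat) (b : B.carrier) : A ⟶ B :=
  ⟨fun _ => b, fun r _ _ => (B.is_convex.idem r b).symm⟩

lemma subsingleton_of_isTerminal {T : CvxCat} (hT : IsTerminal T) :
    Subsingleton T.carrier :=
  ⟨fun s t => congrFun (congrArg Subtype.val
    (hT.hom_ext (constHom T T s) (constHom T T t))) s⟩

/-- An affine map out of a countable coproduct is determined at each given element by its
restriction to finitely many summands. -/
lemma exists_finite_dependence {T A : CvxCat} (a : ℕ → (T ⟶ A))
    (hA : IsColimit (Cofan.mk A a)) (y : A.carrier) :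
    ∃ n : ℕ, ∀ (B : CvxCat) (f g : A ⟶ B), (∀ i < n, a i ≫ f = a i ≫ g) → f.1 y = g.1 y := by
  let S : Set A.carrier := {y | ∃ n : ℕ, ∀ (B : CvxCat) (f g : A ⟶ B),
    (∀ i < n, a i ≫ f = a i ≫ g) → f.1 y = g.1 y}
  have hS : ∀ r, ∀ x ∈ S, ∀ y ∈ S, A.comb r x y ∈ S := by
    rintro r x ⟨m, hm⟩ y ⟨n, hn⟩
    refine ⟨max m n, fun B f g h => ?_⟩
    rw [f.2, g.2, hm B f g fun i hi => h i (lt_max_of_lt_left hi),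
      hn B f g fun i hi => h i (lt_max_of_lt_right hi)]
  have haS : ∀ i t, (a i).1 t ∈ S := fun i t =>
    ⟨i + 1, fun B f g h => congrFun (congrArg Subtype.val (h i i.lt_succ_self)) t⟩
  let b : ∀ i, T ⟶ A.sub S hS := fun i =>
    ⟨fun t => ⟨(a i).1 t, haS i t⟩, fun r s t => Subtype.ext ((a i).2 r s t)⟩
  let d : A ⟶ A.sub S hS := Cofan.IsColimit.desc hA b
  have hd : d ≫ A.subInclusion S hS = 𝟙 A := by
    refine Cofan.IsColimit.hom_ext hA _ _ fun i => ?_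
    have h : a i ≫ d = b i := Cofan.IsColimit.fac hA b i
    change a i ≫ d ≫ A.subInclusion S hS = a i ≫ 𝟙 A
    rw [← Category.assoc, h, Category.comp_id]
    rfl
  have hy : (d.1 y).1 = y := congrFun (congrArg Subtype.val hd) y
  exact hy ▸ (d.1 y).2

/-- Each point of a countable copower of the terminal convex space is determined by finitely
many of the injections. -/
lemma exists_finite_dependence_point {T A : CvxCat} (hT : IsTerminal T) (a : ℕ → (T ⟶ A))
    (hA : IsColimit (Cofan.mk A a)) (x : T ⟶ A) :
    ∃ n : ℕ, ∀ (B : CvxCat) (f g : A ⟶ B),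
      (∀ i < n, a i ≫ f = a i ≫ g) → x ≫ f = x ≫ g := by
  have := subsingleton_of_isTerminal hT
  rcases isEmpty_or_nonempty T.carrier with hE | ⟨⟨t⟩⟩
  · exact ⟨0, fun B f g _ => Subtype.ext (funext fun t => hE.elim t)⟩
  · obtain ⟨n, hn⟩ := exists_finite_dependence a hA (x.1 t)
    refine ⟨n, fun B f g h => Subtype.ext (funext fun s => ?_)⟩
    rw [Subsingleton.elim s t]
    exact hn B f g h

end CvxCat

section GiryMonadLaws

open MeasureTheory

variable {X Y : Type*} [MeasurableSpace X] [MeasurableSpace Y]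

lemma measurable_probabilityMeasure_mk {f : X → ProbabilityMeasure Y}
    (hf : Measurable fun x => (f x).toMeasure) : Measurable f :=
  measurable_comap_iff.2 hf

lemma measurable_pushforward {f : X → Y} (hf : Measurable f) : Measurable (pushforward f hf) :=
  measurable_probabilityMeasure_mk ((Measure.measurable_map f hf).comp measurable_toMeasure)

lemma measurable_dirac : Measurable (dirac : X → ProbabilityMeasure X) :=
  measurable_probabilityMeasure_mk Measure.measurable_dirac

lemma measurable_join :
    Measurable (join : ProbabilityMeasure (ProbabilityMeasure X) → ProbabilityMeasure X) :=
  measurable_probabilityMeasure_mk (Measure.measurable_join.comp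
    ((Measure.measurable_map _ measurable_toMeasure).comp measurable_toMeasure))

lemma pushforward_dirac {f : X → Y} (hf : Measurable f) (x : X) :
    pushforward f hf (dirac x) = dirac (f x) :=
  Subtype.ext (Measure.map_dirac' hf x)

lemma join_dirac (φ : ProbabilityMeasure X) : join (dirac φ) = φ := by
  apply Subtype.ext
  change Measure.join (Measure.map _ (Measure.dirac φ)) = φ.toMeasure
  rw [Measure.map_dirac' measurable_toMeasure, Measure.join_dirac]

lemma join_pushforward_dirac (φ : ProbabilityMeasure X) :
    join (pushforward dirac measurable_dirac φ) = φ := by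
  apply Subtype.ext
  change Measure.join (Measure.map _ (Measure.map _ φ.toMeasure)) = φ.toMeasure
  rw [Measure.map_map measurable_toMeasure measurable_dirac]
  exact Measure.join_map_dirac _

lemma join_pushforward_pushforward {f : X → Y} (hf : Measurable f)
    (Φ : ProbabilityMeasure (ProbabilityMeasure X)) :
    join (pushforward (pushforward f hf) (measurable_pushforward hf) Φ) =
      pushforward f hf (join Φ) := by
  apply Subtype.ext
  change Measure.join (Measure.map _ (Measure.map _ Φ.toMeasure)) =
    Measure.map f (Measure.join (Measure.map _ Φ.toMeasure))
  rw [← Measure.join_map_map hf, Measure.map_map measurable_toMeasure (measurable_pushforward hf),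
    Measure.map_map (Measure.measurable_map f hf) measurable_toMeasure]
  rfl

lemma join_pushforward_join
    (Φ : ProbabilityMeasure (ProbabilityMeasure (ProbabilityMeasure X))) :
    join (pushforward join measurable_join Φ) = join (join Φ) := by
  apply Subtype.ext
  change Measure.join (Measure.map _ (Measure.map _ Φ.toMeasure)) =
    Measure.join (Measure.map _ (Measure.join (Measure.map _ Φ.toMeasure)))
  rw [← Measure.join_map_map measurable_toMeasure, ← Measure.join_map_join,
    Measure.map_map measurable_toMeasure measurable_join,
    Measure.map_map (Measure.measurable_map _ measurable_toMeasure) measurable_toMeasure,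
    Measure.map_map Measure.measurable_join
      ((Measure.measurable_map _ measurable_toMeasure).comp measurable_toMeasure)]
  rfl

end GiryMonadLaws

namespace GiryAlg

open MeasureTheory Limits

/-- The free Giry algebra `G(X)`. -/
noncomputable def free (X : Type) [MeasurableSpace X] : GiryAlg where
  carrier := ProbabilityMeasure X
  str := join
  measurable_str := measurable_join
  str_dirac := join_dirac
  str_join := join_pushforward_join

/-- The one-point Giry algebra. -/
noncomputable def point : GiryAlg where
  carrier := Unit
  str _ := ()
  measurable_str := measurable_const
  str_dirac _ := rfl
  str_join _ := rfl

/-- The one-point Giry algebra is terminal. -/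
noncomputable def isTerminalPoint : IsTerminal point :=
  IsTerminal.ofUniqueHom (fun _ => ⟨fun _ => (), measurable_const, fun _ => rfl⟩)
    fun _ _ => Subtype.ext rfl

/-- The morphism from the one-point algebra picking out an element. -/
noncomputable def pointHom (A : GiryAlg) (x : A.carrier) : point ⟶ A :=
  ⟨fun _ => x, measurable_const, fun φ => by
    have h : pushforward (fun _ : point.carrier => x) measurable_const φ = dirac x :=
      Subtype.ext (by
        change Measure.map _ φ.toMeasure = Measure.dirac x
        rw [Measure.map_const, measure_univ, one_smul])
    rw [h, A.str_dirac]⟩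

lemma str_pushforward_join {X : Type} [MeasurableSpace X] (A : GiryAlg) {b : X → A.carrier}
    (hb : Measurable b) (Φ : ProbabilityMeasure (ProbabilityMeasure X)) :
    A.str (pushforward b hb (join Φ)) = A.str (pushforward (A.str ∘ pushforward b hb)
      (A.measurable_str.comp (measurable_pushforward hb)) Φ) := by
  rw [pushforward_comp (measurable_pushforward hb) A.measurable_str, A.str_join,
    join_pushforward_pushforward]

lemma eq_str_pushforward {X : Type} [MeasurableSpace X] (A : GiryAlg)
    {f : ProbabilityMeasure X → A.carrier} (hf : Measurable f)
    (h : ∀ Φ, f (join Φ) = A.str (pushforward f hf Φ)) {b : X → A.carrier} (hb : Measurable b)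
    (hfb : ∀ x, f (dirac x) = b x) (φ : ProbabilityMeasure X) :
    f φ = A.str (pushforward b hb φ) := by
  obtain rfl : f ∘ dirac = b := funext hfb
  rw [pushforward_comp measurable_dirac hf, ← h, join_pushforward_dirac]

/-- The extension of a measurable map `X → A` to a morphism `G(X) ⟶ A`. -/
noncomputable def freeLift {X : Type} [MeasurableSpace X] {A : GiryAlg} (b : X → A.carrier)
    (hb : Measurable b) : free X ⟶ A :=
  ⟨fun φ => A.str (pushforward b hb φ), A.measurable_str.comp (measurable_pushforward hb),
    str_pushforward_join A hb⟩

lemma freeLift_dirac {X : Type} [MeasurableSpace X] {A : GiryAlg} (b : X → A.carrier)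
    (hb : Measurable b) (x : X) : (freeLift b hb).1 (dirac x) = b x := by
  change A.str (pushforward b hb (dirac x)) = b x
  rw [pushforward_dirac, A.str_dirac]

lemma free_hom_ext {X : Type} [MeasurableSpace X] {A : GiryAlg} {f g : free X ⟶ A}
    (h : ∀ x, f.1 (dirac x) = g.1 (dirac x)) : f = g := by
  obtain ⟨f, hf, hf'⟩ := f
  obtain ⟨g, hg, hg'⟩ := g
  have hb : Measurable fun x : X => g (dirac x) := hg.comp measurable_dirac
  exact Subtype.ext (funext fun φ => (eq_str_pushforward A hf hf' hb h φ).trans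
    (eq_str_pushforward A hg hg' hb (fun _ => rfl) φ).symm)

/-- The free Giry algebra on `ℕ` is a countable copower of the one-point algebra. -/
noncomputable def isColimitFreeNat :
    IsColimit (Cofan.mk (free ℕ) fun i : ℕ => pointHom (free ℕ) (dirac i)) :=
  Cofan.IsColimit.mk _
    (fun t => freeLift (fun i => (t.inj i).1 ()) (measurable_of_countable _))
    (fun _ i => Subtype.ext (funext fun _ => freeLift_dirac _ _ i))
    (fun t _ hm => free_hom_ext fun i =>
      (congrFun (congrArg Subtype.val (hm i)) ()).trans
        (freeLift_dirac (fun i => (t.inj i).1 ()) _ i).symm)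

/-- A probability measure on `ℕ` with full support. -/
noncomputable def poisson : ProbabilityMeasure ℕ :=
  ⟨ProbabilityTheory.poissonMeasure 1, inferInstance⟩

/-- The endomorphism of `G(ℕ)` induced by truncation at `n`. -/
noncomputable def truncate (n : ℕ) : free ℕ ⟶ free ℕ :=
  freeLift (A := free ℕ) (fun i => (dirac (min i n) : ProbabilityMeasure ℕ))
    (measurable_of_countable _)

lemma truncate_poisson_ne (n : ℕ) : (truncate n).1 poisson ≠ poisson := by
  intro h
  have hmin : Measurable fun i : ℕ => min i n := measurable_of_countable _
  have h₁ : (truncate n).1 poisson = pushforward (fun i => min i n) hmin poisson := by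
    change join (pushforward (dirac ∘ fun i => min i n) (measurable_dirac.comp hmin) poisson) = _
    rw [pushforward_comp hmin measurable_dirac, join_pushforward_dirac]
  have h₂ : Measure.map (fun i => min i n) (ProbabilityTheory.poissonMeasure 1) =
      ProbabilityTheory.poissonMeasure 1 :=
    congrArg ProbabilityMeasure.toMeasure (h₁.symm.trans h)
  have h₃ := ProbabilityTheory.poissonMeasure_real_singleton_pos (n + 1)
    (one_pos : 0 < (1 : NNReal))
  have h₄ : (fun i => min i n) ⁻¹' {n + 1} = (∅ : Set ℕ) := by
    ext i
    simp only [Set.mem_preimage, Set.mem_singleton_iff, Set.mem_empty_iff_false, iff_false]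
    omega
  rw [← h₂, measureReal_def, Measure.map_apply hmin (measurableSet_singleton _), h₄] at h₃
  simp at h₃

lemma truncate_dirac {i n : ℕ} (h : i ≤ n) : (truncate n).1 (dirac i) = dirac i := by
  refine (freeLift_dirac _ _ i).trans ?_
  rw [min_eq_left h]

end GiryAlg

/-- **Theorem (statement 1).** The category of Giry algebras is not equivalent to the
category of convex spaces. -/
theorem GiryAlg_not_equivalent_to_CvxCat :
    IsEmpty (GiryAlg ≌ CvxCat) := by
  refine ⟨fun E => ?_⟩
  obtain ⟨n, hn⟩ := CvxCat.exists_finite_dependence_point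
    (Limits.IsTerminal.isTerminalObj E.functor _ GiryAlg.isTerminalPoint) _
    (Limits.isColimitCofanMkObjOfIsColimit E.functor _ _ GiryAlg.isColimitFreeNat)
    (E.functor.map (GiryAlg.pointHom (GiryAlg.free ℕ) GiryAlg.poisson))
  have h := hn _ (E.functor.map (GiryAlg.truncate n)) (E.functor.map (𝟙 _)) fun i hi => by
    rw [← E.functor.map_comp, ← E.functor.map_comp]
    exact congrArg E.functor.map
      (Subtype.ext (funext fun _ => GiryAlg.truncate_dirac hi.le))
  rw [← E.functor.map_comp, ← E.functor.map_comp] at h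
  exact GiryAlg.truncate_poisson_ne n
    (congrFun (congrArg Subtype.val (E.functor.map_injective h)) ())

end Paper
end

section
/- Let M be a set and let A be the free convex space over M, realized as the set of functions x : M → [0,1] such that x⁻¹(0) is cofinite in M (x has finite support) and Σ_{m∈M} x(m) = 1, with the pointwise convex structure x +_r y = (1−r)x + ry. Let Cvx(A,I) be the set of affine maps from A to the unit interval I = [0,1] (maps g with g((1−r)x + ry) = (1−r)g(x) + r g(y) for all x,y ∈ A, r ∈ [0,1]), equipped with the σ-algebra generated by the evaluations g ↦ g(x) for x ∈ A. Then the map f : I^M → Cvx(A,I) defined by f(α)(x) = Σ_{m∈M} α(m)x(m) is a bijection onto Cvx(A,I) that is an isomorphism of measurable spaces, where I^M carries the σ-algebra generated by the evaluations α ↦ α(m); moreover f sends the constant zero function 0̄ ∈ I^M to the constant zero affine map A → I. -/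
namespace Paper

/-- The free convex space over `M`, realized as the set of functions `x : M → [0,1]`
with `x⁻¹(0)` cofinite (i.e. finite support) and `∑ₘ x(m) = 1`. -/
def FreeCvx (M : Type*) : Type _ :=
  {x : M → unitInterval //
    (Function.support fun m => (x m : ℝ)).Finite ∧ ∑' m, ((x m : ℝ)) = 1}

/-- A map `g` from the free convex space (with its pointwise convex structure) to the
unit interval is affine: whenever `z` is the pointwise convex combination
`(1-r)·x + r·y`, one has `g z = (1-r)·g x + r·g y`. -/
def IsAffineFn {M : Type*} (g : FreeCvx M → unitInterval) : Prop :=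
  ∀ r : unitInterval, ∀ x y z : FreeCvx M,
    (∀ m, ((z.1 m : ℝ)) = (1 - (r : ℝ)) * (x.1 m : ℝ) + (r : ℝ) * (y.1 m : ℝ)) →
    ((g z : ℝ)) = (1 - (r : ℝ)) * (g x : ℝ) + (r : ℝ) * (g y : ℝ)

namespace FreeCvx

variable {M : Type*}

theorem tsum_mul_eq_sum (α : M → unitInterval) (x : FreeCvx M) {s : Finset M}
    (hs : ∀ m ∉ s, (x.1 m : ℝ) = 0) :
    ∑' m, (α m : ℝ) * (x.1 m : ℝ) = ∑ m ∈ s, (α m : ℝ) * (x.1 m : ℝ) :=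
  tsum_eq_sum fun m hm => by rw [hs m hm, mul_zero]

theorem sum_eq_one (x : FreeCvx M) {s : Finset M} (hs : ∀ m ∉ s, (x.1 m : ℝ) = 0) :
    ∑ m ∈ s, (x.1 m : ℝ) = 1 :=
  (tsum_eq_sum hs).symm.trans x.2.2

theorem exists_support_finset (x : FreeCvx M) :
    ∃ s : Finset M, ∀ m ∉ s, (x.1 m : ℝ) = 0 :=
  ⟨x.2.1.toFinset, fun m hm => by simpa using hm⟩

/-- Nonnegative real weights supported on a finset and summing to one define a point of the
free convex space. -/
theorem exists_of_weights (s : Finset M) (w : M → ℝ) (hw : ∀ m, 0 ≤ w m)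
    (hs : ∀ m ∉ s, w m = 0) (hsum : ∑ m ∈ s, w m = 1) :
    ∃ x : FreeCvx M, ∀ m, (x.1 m : ℝ) = w m := by
  have hle : ∀ m, w m ≤ 1 := fun m => by
    by_cases hm : m ∈ s
    · exact hsum ▸ Finset.single_le_sum (fun i _ => hw i) hm
    · rw [hs m hm]
      exact zero_le_one
  refine ⟨⟨fun m => ⟨w m, hw m, hle m⟩, ?_, ?_⟩, fun m => rfl⟩
  · refine s.finite_toSet.subset fun m hm => ?_
    by_contra h
    exact hm (hs m h)
  · exact (tsum_eq_sum hs).trans hsum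

open Classical in
/-- The vertex of the free convex space corresponding to a generator. -/
noncomputable def vertex (a : M) : FreeCvx M :=
  ⟨fun m => if m = a then 1 else 0,
    (Set.finite_singleton a).subset fun m hm => by
      by_contra h
      exact hm (by simp [show m ≠ a from h]),
    (tsum_eq_single a fun m hm => by simp [hm]).trans (by simp)⟩

theorem vertex_self (a : M) : ((vertex a).1 a : ℝ) = 1 := by simp [vertex]

theorem vertex_of_ne {a m : M} (h : m ≠ a) : ((vertex a).1 m : ℝ) = 0 := by simp [vertex, h]

theorem tsum_mul_vertex (α : M → unitInterval) (a : M) :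
    ∑' m, (α m : ℝ) * ((vertex a).1 m : ℝ) = α a := by
  rw [tsum_eq_single a fun m hm => by rw [vertex_of_ne hm, mul_zero], vertex_self, mul_one]

theorem tsum_mul_mem (α : M → unitInterval) (x : FreeCvx M) :
    ∑' m, (α m : ℝ) * (x.1 m : ℝ) ∈ unitInterval := by
  obtain ⟨s, hs⟩ := x.exists_support_finset
  rw [tsum_mul_eq_sum α x hs]
  refine ⟨Finset.sum_nonneg fun m _ => mul_nonneg (α m).2.1 (x.1 m).2.1, ?_⟩
  exact (Finset.sum_le_sum fun m _ => mul_le_of_le_one_left (x.1 m).2.1 (α m).2.2).trans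
    (x.sum_eq_one hs).le

/-- The extension of a function on the generators to the free convex space. -/
noncomputable def extend (α : M → unitInterval) (x : FreeCvx M) : unitInterval :=
  ⟨∑' m, (α m : ℝ) * (x.1 m : ℝ), tsum_mul_mem α x⟩

theorem isAffineFn_extend (α : M → unitInterval) : IsAffineFn (extend α) := by
  classical
  intro r x y z hz
  obtain ⟨s, hs⟩ := x.exists_support_finset
  obtain ⟨t, ht⟩ := y.exists_support_finset
  have hx : ∀ m ∉ s ∪ t, (x.1 m : ℝ) = 0 := fun m hm =>
    hs m fun h => hm (Finset.mem_union_left t h)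
  have hy : ∀ m ∉ s ∪ t, (y.1 m : ℝ) = 0 := fun m hm =>
    ht m fun h => hm (Finset.mem_union_right s h)
  have hz0 : ∀ m ∉ s ∪ t, (z.1 m : ℝ) = 0 := fun m hm => by simp [hz, hx m hm, hy m hm]
  simp only [extend]
  rw [tsum_mul_eq_sum α x hx, tsum_mul_eq_sum α y hy, tsum_mul_eq_sum α z hz0,
    Finset.mul_sum, Finset.mul_sum, ← Finset.sum_add_distrib]
  refine Finset.sum_congr rfl fun m _ => ?_
  rw [hz]
  ring

theorem _root_.Paper.IsAffineFn.eq_sum {g : FreeCvx M → unitInterval} (hg : IsAffineFn g)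
    (s : Finset M) (x : FreeCvx M) (hs : ∀ m ∉ s, (x.1 m : ℝ) = 0) :
    (g x : ℝ) = ∑ m ∈ s, (g (vertex m) : ℝ) * (x.1 m : ℝ) := by
  classical
  induction s using Finset.induction_on generalizing x with
  | empty => exact absurd (x.sum_eq_one hs) (by simp)
  | insert a s ha ih =>
    have hsum := x.sum_eq_one hs
    rw [Finset.sum_insert ha] at hsum ⊢
    rcases eq_or_ne (x.1 a : ℝ) 1 with h1 | h1
    · have hzero : ∀ m ∈ s, (x.1 m : ℝ) = 0 :=
        (Finset.sum_eq_zero_iff_of_nonneg fun m _ => (x.1 m).2.1).1 (by linarith)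
      have hx : x = vertex a := by
        refine Subtype.ext (funext fun m => Subtype.ext ?_)
        rcases eq_or_ne m a with rfl | hm
        · rw [h1, vertex_self]
        · rw [vertex_of_ne hm]
          by_cases hms : m ∈ s
          · exact hzero m hms
          · exact hs m (by simp [hm, hms])
      rw [Finset.sum_eq_zero fun m hm => by rw [hzero m hm, mul_zero], h1, ← hx]
      ring
    · have hpos : 0 < 1 - (x.1 a : ℝ) := sub_pos.2 (lt_of_le_of_ne (x.1 a).2.2 h1)
      obtain ⟨y, hy⟩ := exists_of_weights s
        (fun m => if m ∈ s then (x.1 m : ℝ) / (1 - (x.1 a : ℝ)) else 0)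
        (fun m => by
          split_ifs
          · exact div_nonneg (x.1 m).2.1 hpos.le
          · exact le_rfl)
        (fun m hm => if_neg hm)
        (by
          rw [Finset.sum_congr rfl fun m hm => if_pos hm, ← Finset.sum_div,
            div_eq_one_iff_eq hpos.ne']
          linarith)
      have hxy := hg (x.1 a) y (vertex a) x fun m => by
        rw [hy]
        rcases eq_or_ne m a with rfl | hm
        · rw [if_neg ha, vertex_self]
          ring
        · rw [vertex_of_ne hm]
          split_ifs with hms
          · field_simp
            ring
          · rw [hs m (by simp [hm, hms])]
            ring
      rw [hxy, ih y fun m hm => by rw [hy, if_neg hm], Finset.mul_sum, add_comm, mul_comm]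
      congr 1
      refine Finset.sum_congr rfl fun m hm => ?_
      rw [hy, if_pos hm]
      field_simp

theorem extend_vertex {g : FreeCvx M → unitInterval} (hg : IsAffineFn g) :
    extend (fun m => g (vertex m)) = g := by
  refine funext fun x => Subtype.ext ?_
  obtain ⟨s, hs⟩ := x.exists_support_finset
  exact (tsum_mul_eq_sum _ x hs).trans (hg.eq_sum s x hs).symm

theorem measurable_extend :
    Measurable (extend : (M → unitInterval) → FreeCvx M → unitInterval) := by
  refine measurable_pi_lambda _ fun x => Measurable.subtype_mk ?_
  obtain ⟨s, hs⟩ := x.exists_support_finset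
  simp only [tsum_mul_eq_sum _ x hs]
  exact Finset.measurable_fun_sum s fun m _ =>
    (measurable_subtype_coe.comp (measurable_pi_apply m)).mul_const _

end FreeCvx

/-- **Lemma (statement 3).** The map `f : I^M → Cvx(A, I)`, `f(α)(x) = ∑ₘ α(m)·x(m)`
(where `A` is the free convex space over `M` and `Cvx(A,I)` is the set of affine maps
`A → I` with the σ-algebra generated by the evaluations `g ↦ g x`), is a bijection and
an isomorphism of measurable spaces, sending the constant zero function of `I^M` to the
constant zero affine map. -/
theorem freeCvx_dual_measurableEquiv (M : Type*) :
    ∃ f : (M → unitInterval) ≃ᵐ {g : FreeCvx M → unitInterval // IsAffineFn g},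
      (∀ (α : M → unitInterval) (x : FreeCvx M),
        (((f α).1 x : ℝ)) = ∑' m, (α m : ℝ) * (x.1 m : ℝ)) ∧
      (∀ x : FreeCvx M, (((f (fun _ => 0)).1 x : ℝ)) = 0) := by
  refine ⟨{
    toFun := fun α => ⟨FreeCvx.extend α, FreeCvx.isAffineFn_extend α⟩
    invFun := fun g m => g.1 (FreeCvx.vertex m)
    left_inv := fun α => funext fun m => Subtype.ext (FreeCvx.tsum_mul_vertex α m)
    right_inv := fun g => Subtype.ext (FreeCvx.extend_vertex g.2)
    measurable_toFun := FreeCvx.measurable_extend.subtype_mk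
    measurable_invFun := measurable_pi_lambda _ fun m =>
      (measurable_pi_apply (FreeCvx.vertex m)).comp measurable_subtype_coe }, fun α x => rfl, fun x => ?_⟩
  change ∑' m, (((0 : unitInterval) : ℝ)) * (x.1 m : ℝ) = 0
  simp

end Paper
end

section
/- Let A be a convex space and K a subset of A. Let 2 = {0,1} carry the convex structure determined by 0 +_r 1 = 0 if r < 1 and 0 +_r 1 = 1 if r = 1 (together with the convex-space axioms). Then the characteristic function χ_K : A → 2 (with χ_K(x) = 1 iff x ∈ K) is affine if and only if K is convex (closed under all operations +_r) and K satisfies the coconvexity condition: for all r < 1 and all x, y ∈ A, if x +_r y ∈ K then x ∈ K. -/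
namespace Paper

/-- The convex structure on the two-point space `2 = {0,1}` (encoded as `Bool`)
determined by `0 +ᵣ 1 = 0` for `r < 1` and `0 +₁ 1 = 1`. -/
noncomputable def twoComb (r : unitInterval) (x y : Bool) : Bool :=
  if r = 0 then x else if r = 1 then y else (x && y)

open Classical in
/-- The characteristic function of a subset `K`, valued in `2 = {0,1}` (as `Bool`). -/
noncomputable def chi {A : Type*} (K : Set A) (a : A) : Bool :=
  if a ∈ K then true else false

theorem chi_eq_true_iff {A : Type*} (K : Set A) (a : A) : chi K a = true ↔ a ∈ K := by
  simp [chi]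

theorem chi_eq_iff {A : Type*} (K : Set A) (a : A) (b : Bool) :
    chi K a = b ↔ (a ∈ K ↔ b = true) := by
  rw [Bool.eq_iff_iff, chi_eq_true_iff]

theorem IsConvexStruct.comb_one {A : Type*} {comb : unitInterval → A → A → A}
    (hc : IsConvexStruct comb) (x y : A) : comb 1 x y = y := by
  rw [hc.comm, unitInterval.symm_one, hc.unit]

/-- **Lemma 2 (statement 4).** For a convex space `A` and `K ⊆ A`, the characteristic
function `χ_K : A → 2` is affine if and only if `K` is convex and coconvex
(`x +ᵣ y ∈ K → x ∈ K` whenever `r < 1`). -/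
theorem chi_affine_iff {A : Type*} {comb : unitInterval → A → A → A}
    (hc : IsConvexStruct comb) (K : Set A) :
    (∀ (r : unitInterval) (x y : A), chi K (comb r x y) = twoComb r (chi K x) (chi K y))
      ↔ (∀ (r : unitInterval) (x y : A), x ∈ K → y ∈ K → comb r x y ∈ K) ∧
        (∀ (r : unitInterval) (x y : A), (r : ℝ) < 1 → comb r x y ∈ K → x ∈ K) := by
  simp only [chi_eq_iff]
  constructor
  · intro h
    constructor
    · intro r x y hx hy
      rw [h, twoComb, (chi_eq_true_iff K x).2 hx, (chi_eq_true_iff K y).2 hy]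
      simp
    · intro r x y hr hxy
      have hr1 : r ≠ 1 := by
        rintro rfl
        simp at hr
      rw [h, twoComb, if_neg hr1] at hxy
      rw [← chi_eq_true_iff]
      split_ifs at hxy
      · exact hxy
      · exact (Bool.and_eq_true_iff.1 hxy).1
  · rintro ⟨hconv, hco⟩ r x y
    rw [twoComb]
    split_ifs with h0 h1
    · rw [h0, hc.unit, chi_eq_true_iff]
    · rw [h1, hc.comb_one, chi_eq_true_iff]
    · rw [Bool.and_eq_true_iff, chi_eq_true_iff, chi_eq_true_iff]
      refine ⟨fun hxy => ⟨hco r x y (unitInterval.lt_one_iff_ne_one.2 h1) hxy, ?_⟩,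
        fun hxy => hconv r x y hxy.1 hxy.2⟩
      rw [hc.comm] at hxy
      refine hco _ y x ?_ hxy
      have hr : (0 : ℝ) < r := unitInterval.pos_iff_ne_zero.2 h0
      rw [unitInterval.coe_symm_eq]
      linarith

end Paper
end

section
/- Let (X,κ) be a Giry algebra. Define, for r ∈ [0,1] and α, β ∈ X, the operation α +_r β := κ((1−r)δ_α + r δ_β), where δ denotes the Dirac measure. Then these operations make X a convex space: they satisfy the unit law x +_0 y = x, idempotency x +_r x = x, parametric commutativity x +_r y = y +_{1−r} x, and deformed parametric associativity (x +_r y) +_s z = x +_t (y +_{s/t} z) for s > 0 and t = r + s − rs. -/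
namespace Paper

section PcombLaws

open MeasureTheory

variable {X : Type*} [MeasurableSpace X]

lemma pcomb_zero (φ ψ : ProbabilityMeasure X) : pcomb 0 φ ψ = φ := by
  apply Subtype.ext
  change ENNReal.ofReal (1 - (0 : ℝ)) • φ.toMeasure + ENNReal.ofReal (0 : ℝ) • ψ.toMeasure
    = φ.toMeasure
  simp

lemma pcomb_self (r : unitInterval) (φ : ProbabilityMeasure X) : pcomb r φ φ = φ := by
  apply Subtype.ext
  change ENNReal.ofReal (1 - (r : ℝ)) • φ.toMeasure + ENNReal.ofReal (r : ℝ) • φ.toMeasure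
    = φ.toMeasure
  rw [← add_smul, ← ENNReal.ofReal_add (by linarith [r.2.2]) r.2.1]
  simp

lemma pcomb_comm (r : unitInterval) (φ ψ : ProbabilityMeasure X) :
    pcomb r φ ψ = pcomb (unitInterval.symm r) ψ φ := by
  apply Subtype.ext
  change ENNReal.ofReal (1 - (r : ℝ)) • φ.toMeasure + ENNReal.ofReal (r : ℝ) • ψ.toMeasure
    = ENNReal.ofReal (1 - (1 - (r : ℝ))) • ψ.toMeasure
      + ENNReal.ofReal (1 - (r : ℝ)) • φ.toMeasure
  rw [sub_sub_cancel, add_comm]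

lemma pcomb_assoc (r s t u : unitInterval) (hs : 0 < (s : ℝ))
    (ht : (t : ℝ) = r + s - r * s) (hu : (u : ℝ) = (s : ℝ) / (t : ℝ))
    (φ ψ χ : ProbabilityMeasure X) :
    pcomb s (pcomb r φ ψ) χ = pcomb t φ (pcomb u ψ χ) := by
  have hs1 : 0 ≤ 1 - (s : ℝ) := by linarith [s.2.2]
  have ht0 : 0 < (t : ℝ) := by nlinarith [mul_nonneg r.2.1 hs1]
  have htu : (t : ℝ) * u = s := by rw [hu]; field_simp
  apply Subtype.ext
  change ENNReal.ofReal (1 - (s : ℝ)) •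
      (ENNReal.ofReal (1 - (r : ℝ)) • φ.toMeasure + ENNReal.ofReal (r : ℝ) • ψ.toMeasure)
      + ENNReal.ofReal (s : ℝ) • χ.toMeasure
    = ENNReal.ofReal (1 - (t : ℝ)) • φ.toMeasure + ENNReal.ofReal (t : ℝ) •
      (ENNReal.ofReal (1 - (u : ℝ)) • ψ.toMeasure + ENNReal.ofReal (u : ℝ) • χ.toMeasure)
  simp only [smul_add, smul_smul]
  rw [← ENNReal.ofReal_mul hs1, ← ENNReal.ofReal_mul hs1, ← ENNReal.ofReal_mul ht0.le,
    ← ENNReal.ofReal_mul ht0.le, htu, add_assoc,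
    show (1 - (s : ℝ)) * (1 - r) = 1 - t by rw [ht]; ring,
    show (1 - (s : ℝ)) * r = t * (1 - u) by rw [mul_sub, htu, ht]; ring]

lemma pushforward_pcomb_dirac {Y : Type*} [MeasurableSpace Y] (f : X → Y) (hf : Measurable f)
    (r : unitInterval) (x y : X) :
    pushforward f hf (pcomb r (dirac x) (dirac y)) = pcomb r (dirac (f x)) (dirac (f y)) := by
  apply Subtype.ext
  change (ENNReal.ofReal (1 - (r : ℝ)) • Measure.dirac x
      + ENNReal.ofReal (r : ℝ) • Measure.dirac y).map f
    = ENNReal.ofReal (1 - (r : ℝ)) • Measure.dirac (f x)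
      + ENNReal.ofReal (r : ℝ) • Measure.dirac (f y)
  rw [Measure.map_add _ _ hf, Measure.map_smul, Measure.map_smul, Measure.map_dirac' hf,
    Measure.map_dirac' hf]

lemma join_pcomb_dirac (r : unitInterval) (φ ψ : ProbabilityMeasure X) :
    join (pcomb r (dirac φ) (dirac ψ)) = pcomb r φ ψ := by
  apply Subtype.ext
  change ((ENNReal.ofReal (1 - (r : ℝ)) • Measure.dirac φ
      + ENNReal.ofReal (r : ℝ) • Measure.dirac ψ).map ProbabilityMeasure.toMeasure).join
    = ENNReal.ofReal (1 - (r : ℝ)) • φ.toMeasure + ENNReal.ofReal (r : ℝ) • ψ.toMeasure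
  rw [Measure.map_add _ _ measurable_toMeasure, Measure.map_smul, Measure.map_smul,
    Measure.map_dirac' measurable_toMeasure, Measure.map_dirac' measurable_toMeasure]
  ext K hK
  rw [Measure.join_apply hK, lintegral_add_measure, lintegral_smul_measure,
    lintegral_smul_measure, lintegral_dirac' _ (Measure.measurable_coe hK),
    lintegral_dirac' _ (Measure.measurable_coe hK)]
  rfl

end PcombLaws

/-- For a Giry algebra `(X, κ)`, the operations
`α +ᵣ β := κ((1-r)·δ_α + r·δ_β)` make `X` a convex space: they satisfy the unit law,
idempotency, parametric commutativity and deformed parametric associativity. -/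
theorem inducedComb_isConvexStruct {X : Type*} [MeasurableSpace X]
    (κ : MeasureTheory.ProbabilityMeasure X → X) (hκ : Measurable κ)
    (hdirac : ∀ x, κ (dirac x) = x)
    (hjoin : ∀ Φ : MeasureTheory.ProbabilityMeasure (MeasureTheory.ProbabilityMeasure X),
      κ (pushforward κ hκ Φ) = κ (join Φ)) :
    IsConvexStruct (fun (r : unitInterval) (α β : X) => κ (pcomb r (dirac α) (dirac β))) := by
  have affine : ∀ r φ ψ, κ (pcomb r (dirac (κ φ)) (dirac (κ ψ))) = κ (pcomb r φ ψ) := by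
    intro r φ ψ
    rw [← pushforward_pcomb_dirac κ hκ, hjoin, join_pcomb_dirac]
  refine ⟨fun x y => ?_, fun r x => ?_, fun r x y => ?_, ?_⟩
  · simp only [pcomb_zero, hdirac]
  · simp only [pcomb_self, hdirac]
  · exact congrArg κ (pcomb_comm r _ _)
  · intro r s t u hs ht hu x y z
    have hl := affine s (pcomb r (dirac x) (dirac y)) (dirac z)
    have hr := affine t (dirac x) (pcomb u (dirac y) (dirac z))
    rw [hdirac] at hl hr
    exact hl.trans ((congrArg κ (pcomb_assoc r s t u hs ht hu _ _ _)).trans hr.symm)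

end Paper
end

section
/- Let M be a set and let I^M be the set of all functions M → [0,1] with the σ-algebra generated by the evaluations ev_m(α) = α(m). Define E_M : G(I^M) → I^M by E_M(φ)(m) = ∫_{I^M} ev_m dφ for every probability measure φ on I^M and m ∈ M. Then (I^M, E_M) is a Giry algebra: E_M is measurable, E_M(δ_α) = α for all α ∈ I^M, and E_M ∘ G(E_M) = E_M ∘ μ_{I^M}. -/
namespace Paper

section GiryAlgebra

open MeasureTheory

lemma measurable_coe_eval {M : Type*} (m : M) :
    Measurable fun α : M → unitInterval => (α m : ℝ) :=
  measurable_subtype_coe.comp (measurable_pi_apply m)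

/-- The barycenter of `φ` at `m`, expressed as a Lebesgue integral. -/
lemma coe_EM_eq_toReal_lintegral {M : Type*} (φ : ProbabilityMeasure (M → unitInterval))
    (m : M) :
    (EM M φ m : ℝ) = (∫⁻ α, ENNReal.ofReal (α m : ℝ) ∂φ.toMeasure).toReal :=
  integral_eq_lintegral_of_nonneg_ae (Filter.Eventually.of_forall fun α => (α m).2.1)
    (measurable_coe_eval m).aestronglyMeasurable

lemma ofReal_coe_EM {M : Type*} (φ : ProbabilityMeasure (M → unitInterval)) (m : M) :
    ENNReal.ofReal (EM M φ m : ℝ) = ∫⁻ α, ENNReal.ofReal (α m : ℝ) ∂φ.toMeasure := by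
  rw [coe_EM_eq_toReal_lintegral, ENNReal.ofReal_toReal]
  refine ne_top_of_le_ne_top ENNReal.one_ne_top ?_
  calc ∫⁻ α, ENNReal.ofReal (α m : ℝ) ∂φ.toMeasure
      ≤ ∫⁻ _, 1 ∂φ.toMeasure :=
        lintegral_mono fun α => ENNReal.ofReal_le_one.2 (α m).2.2
    _ = 1 := by simp

lemma measurable_EM (M : Type*) : Measurable (EM M) := by
  refine measurable_pi_lambda _ fun m => Measurable.subtype_mk ?_
  change Measurable fun φ => (EM M φ m : ℝ)
  simp_rw [coe_EM_eq_toReal_lintegral]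
  exact ((Measure.measurable_lintegral (measurable_coe_eval m).ennreal_ofReal).comp
    measurable_toMeasure).ennreal_toReal

lemma EM_dirac {M : Type*} (α : M → unitInterval) : EM M (dirac α) = α := by
  funext m
  exact Subtype.ext (integral_dirac' _ α (measurable_coe_eval m).stronglyMeasurable)

lemma EM_pushforward_EM {M : Type*} (hmeas : Measurable (EM M))
    (Φ : ProbabilityMeasure (ProbabilityMeasure (M → unitInterval))) :
    EM M (pushforward (EM M) hmeas Φ) = EM M (join Φ) := by
  funext m
  apply Subtype.ext
  have hf := (measurable_coe_eval m).ennreal_ofReal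
  rw [coe_EM_eq_toReal_lintegral, coe_EM_eq_toReal_lintegral]
  congr 1
  calc ∫⁻ α, ENNReal.ofReal (α m : ℝ) ∂(Φ.toMeasure.map (EM M))
      = ∫⁻ φ, ENNReal.ofReal (EM M φ m : ℝ) ∂Φ.toMeasure := lintegral_map hf hmeas
    _ = ∫⁻ φ, ∫⁻ α, ENNReal.ofReal (α m : ℝ) ∂φ.toMeasure ∂Φ.toMeasure := by
        simp_rw [ofReal_coe_EM]
    _ = ∫⁻ ν, ∫⁻ α, ENNReal.ofReal (α m : ℝ) ∂ν
          ∂(Φ.toMeasure.map ProbabilityMeasure.toMeasure) :=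
        (lintegral_map (Measure.measurable_lintegral hf) measurable_toMeasure).symm
    _ = ∫⁻ α, ENNReal.ofReal (α m : ℝ)
          ∂(Φ.toMeasure.map ProbabilityMeasure.toMeasure).join :=
        (Measure.lintegral_join hf.aemeasurable).symm

end GiryAlgebra

/-- `(I^M, E_M)` is a Giry algebra: the map
`E_M(φ)(m) = ∫ ev_m dφ` is measurable, sends Dirac measures `δ_α` to `α`, and
satisfies `E_M ∘ G(E_M) = E_M ∘ μ_{I^M}`. -/
theorem EM_isGiryAlgebra (M : Type*) :
    ∃ hmeas : Measurable (EM M),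
      (∀ α : M → unitInterval, EM M (dirac α) = α) ∧
      (∀ Φ : MeasureTheory.ProbabilityMeasure
          (MeasureTheory.ProbabilityMeasure (M → unitInterval)),
        EM M (pushforward (EM M) hmeas Φ) = EM M (join Φ)) := by
  exact ⟨measurable_EM M, EM_dirac, EM_pushforward_EM (measurable_EM M)⟩

end Paper
end

section
/- Let 2 = {0,1} with the discrete σ-algebra and define ε_2 : G(2) → 2 by ε_2 = π_{0,1} ∘ h, where h(φ) = φ({1}) and π_{0,1} : [0,1] → 2 is the path map sending r to 0 if r < 1 and to 1 if r = 1; explicitly, ε_2(φ) = 1 if φ({1}) = 1 and ε_2(φ) = 0 otherwise. Then (2, ε_2) is a Giry algebra (ε_2 is measurable, ε_2(δ_b) = b for b ∈ {0,1}, and ε_2 ∘ G(ε_2) = ε_2 ∘ μ_2), and the convex structure induced on 2 by ε_2 is the usual one: for r ∈ [0,1], ε_2((1−r)δ_0 + r δ_1) = 0 if r < 1 and = 1 if r = 1. -/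
namespace Paper

open Classical in
/-- The structure map `ε₂ = π₀,₁ ∘ h : G(2) → 2`; explicitly `ε₂(φ) = 1` iff
`φ({1}) = 1`.  Here `2 = {0,1}` is encoded as `Bool` (with `1 = true`). -/
noncomputable def eps2 (φ : MeasureTheory.ProbabilityMeasure Bool) : Bool :=
  if φ.toMeasure {true} = 1 then true else false

lemma eps2_eq_true_iff (φ : MeasureTheory.ProbabilityMeasure Bool) :
    eps2 φ = true ↔ φ.toMeasure {true} = 1 := by
  simp [eps2]

lemma measurable_toMeasure_apply {X : Type*} [MeasurableSpace X] {s : Set X}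
    (hs : MeasurableSet s) :
    Measurable fun ξ : MeasureTheory.ProbabilityMeasure X => ξ.toMeasure s :=
  (MeasureTheory.Measure.measurable_coe hs).comp measurable_toMeasure

lemma measurable_eps2 : Measurable eps2 := by
  refine measurable_to_bool ?_
  have h : eps2 ⁻¹' {true} =
      (fun ξ : MeasureTheory.ProbabilityMeasure Bool => ξ.toMeasure {true}) ⁻¹' {1} := by
    ext ξ
    simp [eps2_eq_true_iff]
  rw [h]
  exact measurable_toMeasure_apply (MeasurableSet.singleton true) (MeasurableSet.singleton 1)

lemma eps2_dirac (b : Bool) : eps2 (dirac b) = b := by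
  cases b <;> simp [eps2, dirac]

lemma join_toMeasure_apply {X : Type*} [MeasurableSpace X]
    (Φ : MeasureTheory.ProbabilityMeasure (MeasureTheory.ProbabilityMeasure X)) {s : Set X}
    (hs : MeasurableSet s) :
    (join Φ).toMeasure s = ∫⁻ ξ, ξ.toMeasure s ∂Φ.toMeasure := by
  change (Φ.toMeasure.map MeasureTheory.ProbabilityMeasure.toMeasure).join s = _
  rw [MeasureTheory.Measure.join_apply hs,
    MeasureTheory.lintegral_map (MeasureTheory.Measure.measurable_coe hs) measurable_toMeasure]

lemma lintegral_eq_one_iff_ae_eq_one {X : Type*} [MeasurableSpace X]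
    {μ : MeasureTheory.Measure X} [MeasureTheory.IsProbabilityMeasure μ]
    {f : X → ENNReal} (hle : ∀ x, f x ≤ 1) :
    ∫⁻ x, f x ∂μ = 1 ↔ ∀ᵐ x ∂μ, f x = 1 := by
  constructor
  · intro h
    exact MeasureTheory.ae_eq_of_ae_le_of_lintegral_le (g := fun _ => 1)
      (Filter.Eventually.of_forall hle) (by simp [h]) aemeasurable_const (by simp [h])
  · intro h
    simp [MeasureTheory.lintegral_congr_ae h]

lemma eps2_pushforward_eps2
    (Φ : MeasureTheory.ProbabilityMeasure (MeasureTheory.ProbabilityMeasure Bool)) :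
    eps2 (pushforward eps2 measurable_eps2 Φ) = eps2 (join Φ) := by
  have hpre : MeasurableSet (eps2 ⁻¹' {true}) :=
    measurable_eps2 (MeasurableSet.singleton true)
  rw [Bool.eq_iff_iff, eps2_eq_true_iff, eps2_eq_true_iff,
    join_toMeasure_apply Φ (MeasurableSet.singleton true),
    lintegral_eq_one_iff_ae_eq_one (fun _ => MeasureTheory.prob_le_one)]
  change Φ.toMeasure.map eps2 {true} = 1 ↔ _
  rw [MeasureTheory.Measure.map_apply measurable_eps2 (MeasurableSet.singleton true),
    ← MeasureTheory.mem_ae_iff_prob_eq_one hpre]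
  simp only [← eps2_eq_true_iff]
  rfl

lemma eps2_pcomb_dirac (r : unitInterval) :
    eps2 (pcomb r (dirac false) (dirac true)) = if (r : ℝ) < 1 then false else true := by
  have h : (pcomb r (dirac false) (dirac true)).toMeasure {true} = ENNReal.ofReal r := by
    simp [pcomb, dirac]
  have hr : (r : ℝ) ≤ 1 := r.2.2
  rw [Bool.eq_iff_iff, eps2_eq_true_iff, h, ENNReal.ofReal_eq_one]
  split_ifs with hlt
  · simp [hlt.ne]
  · simp [le_antisymm hr (not_lt.mp hlt)]

/-- `(2, ε₂)` is a Giry algebra (`ε₂` is measurable, `ε₂(δ_b) = b`,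
and `ε₂ ∘ G(ε₂) = ε₂ ∘ μ_2`), and the convex structure induced on `2` by `ε₂` is the
usual one: `ε₂((1-r)δ₀ + rδ₁) = 0` if `r < 1` and `= 1` if `r = 1`. -/
theorem eps2_isGiryAlgebra_and_induced_structure :
    (∃ hmeas : Measurable eps2,
      (∀ b : Bool, eps2 (dirac b) = b) ∧
      (∀ Φ : MeasureTheory.ProbabilityMeasure
          (MeasureTheory.ProbabilityMeasure Bool),
        eps2 (pushforward eps2 hmeas Φ) = eps2 (join Φ))) ∧
    (∀ r : unitInterval,
      eps2 (pcomb r (dirac false) (dirac true)) = if (r : ℝ) < 1 then false else true) := by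
  exact ⟨⟨measurable_eps2, eps2_dirac, eps2_pushforward_eps2⟩, eps2_pcomb_dirac⟩

end Paper
end

section
/- Let M be an uncountable set, I^M the set of functions M → [0,1] with the evaluation σ-algebra, 0̄ ∈ I^M the constant zero function, and 2 = {0,1} with the discrete σ-algebra and the convex structure 0 +_r 1 = 0 for r < 1, 0 +_1 1 = 1. Then the characteristic function χ_{{0̄}} : I^M → 2 of the singleton {0̄} is affine with respect to the pointwise convex structure on I^M and the stated convex structure on 2 (for all α, β ∈ I^M and r ∈ [0,1], χ_{{0̄}}((1−r)α + rβ) = χ_{{0̄}}(α) +_r χ_{{0̄}}(β)), but χ_{{0̄}} is not measurable. In particular, there exists an affine map between the convex spaces induced by the Giry algebras (I^M, E_M) and (2, ε_2) that is not a morphism of Giry algebras, so the functor Φ from Giry algebras to convex spaces is not full. -/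
namespace Paper

/-- The usual convex combination `(1-r)·a + r·b` on the unit interval. -/
noncomputable def icomb (r a b : unitInterval) : unitInterval :=
  ⟨(1 - (r : ℝ)) * (a : ℝ) + (r : ℝ) * (b : ℝ), by
    constructor
    · nlinarith [r.2.1, r.2.2, a.2.1, a.2.2, b.2.1, b.2.2]
    · nlinarith [r.2.1, r.2.2, a.2.1, a.2.2, b.2.1, b.2.2]⟩

section Lemmas

open MeasureTheory

/-- A measurable set of a product space depends on countably many coordinates only. -/
lemma exists_countable_dependsOn_of_measurableSet {ι : Type*} {X : ι → Type*}
    [∀ i, MeasurableSpace (X i)] {A : Set (∀ i, X i)} (hA : MeasurableSet A) :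
    ∃ S : Set ι, S.Countable ∧ DependsOn (fun x => x ∈ A) S := by
  let m : MeasurableSpace (∀ i, X i) :=
    { MeasurableSet' := fun B => ∃ S : Set ι, S.Countable ∧ DependsOn (fun x => x ∈ B) S
      measurableSet_empty := ⟨∅, Set.countable_empty, fun _ _ _ => rfl⟩
      measurableSet_compl := by
        rintro B ⟨S, hS, hB⟩
        exact ⟨S, hS, fun x y h => congrArg Not (hB h)⟩
      measurableSet_iUnion := by
        intro B hB
        choose S hS hB using hB
        refine ⟨⋃ n, S n, Set.countable_iUnion hS, fun x y h => ?_⟩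
        simp only [Set.mem_iUnion]
        exact congrArg _ (funext fun n => hB n fun i hi => h i (Set.mem_iUnion_of_mem n hi)) }
  have hle : MeasurableSpace.pi ≤ m := by
    refine iSup_le fun i => ?_
    rintro _ ⟨t, -, rfl⟩
    refine ⟨{i}, Set.countable_singleton i, fun x y h => ?_⟩
    simp only [Set.mem_preimage, h i rfl]
  exact hle A hA

lemma not_measurableSet_singleton_pi {ι : Type*} {X : Type*} [Uncountable ι] [Nontrivial X]
    [MeasurableSpace X] (a : ι → X) : ¬ MeasurableSet ({a} : Set (ι → X)) := by
  classical
  intro h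
  obtain ⟨S, hS, hdep⟩ := exists_countable_dependsOn_of_measurableSet h
  obtain ⟨i, hi⟩ : ∃ i, i ∉ S := by
    by_contra! hall
    exact Set.not_countable_univ (hS.mono fun i _ => hall i)
  obtain ⟨b, hb⟩ := exists_ne (a i)
  have hmem : (Function.update a i b ∈ ({a} : Set (ι → X))) = (a ∈ ({a} : Set (ι → X))) :=
    hdep fun j hj => Function.update_of_ne (ne_of_mem_of_not_mem hj hi) _ _
  have heq : Function.update a i b = a := hmem.mpr rfl
  exact hb (by simpa using congrFun heq i)

lemma chi_eq_true {A : Type*} {K : Set A} {a : A} : chi K a = true ↔ a ∈ K := by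
  simp [chi]

lemma measurableSet_of_measurable_chi {A : Type*} [MeasurableSpace A] {K : Set A}
    (h : Measurable (chi K)) : MeasurableSet K := by
  have hK : K = chi K ⁻¹' {true} := by
    ext a
    simp [chi_eq_true]
  rw [hK]
  exact h (measurableSet_singleton true)

lemma icomb_eq_zero {r a b : unitInterval} (h0 : r ≠ 0) (h1 : r ≠ 1) :
    icomb r a b = 0 ↔ a = 0 ∧ b = 0 := by
  have hr0 : 0 < (r : ℝ) := unitInterval.pos_iff_ne_zero.mpr h0
  have hr1 : (r : ℝ) < 1 := unitInterval.lt_one_iff_ne_one.mpr h1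
  have hr : 0 < 1 - (r : ℝ) := sub_pos.mpr hr1
  have ha : 0 ≤ (a : ℝ) := a.2.1
  have hb : 0 ≤ (b : ℝ) := b.2.1
  simp only [Subtype.ext_iff, icomb, Set.Icc.coe_zero]
  rw [add_eq_zero_iff_of_nonneg (by positivity) (by positivity)]
  simp [hr.ne', hr0.ne']

lemma icomb_zero_left (a b : unitInterval) : icomb 0 a b = a := by
  simp [icomb]

lemma icomb_one_left (a b : unitInterval) : icomb 1 a b = b := by
  simp [icomb]

lemma chi_zero_icomb {M : Type*} (r : unitInterval) (α β : M → unitInterval) :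
    chi ({fun _ => 0} : Set (M → unitInterval)) (fun m => icomb r (α m) (β m))
      = twoComb r (chi ({fun _ => 0} : Set (M → unitInterval)) α)
          (chi ({fun _ => 0} : Set (M → unitInterval)) β) := by
  by_cases h0 : r = 0
  · simp [h0, twoComb, icomb_zero_left]
  by_cases h1 : r = 1
  · simp [h1, twoComb, icomb_one_left]
  rw [Bool.eq_iff_iff]
  simp [twoComb, h0, h1, chi_eq_true, funext_iff, icomb_eq_zero, forall_and]

lemma EM_pcomb_dirac {M : Type*} (r : unitInterval) (α β : M → unitInterval) :
    EM M (pcomb r (dirac α) (dirac β)) = fun m => icomb r (α m) (β m) := by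
  funext m
  have hmeas : StronglyMeasurable fun γ : M → unitInterval => (γ m : ℝ) :=
    (measurable_subtype_coe.comp (measurable_pi_apply m)).stronglyMeasurable
  have hint (γ : M → unitInterval) :
      Integrable (fun γ : M → unitInterval => (γ m : ℝ)) (Measure.dirac γ) :=
    Integrable.of_bound hmeas.aestronglyMeasurable 1 (Filter.Eventually.of_forall fun γ => by
      rw [Real.norm_of_nonneg (γ m).2.1]
      exact (γ m).2.2)
  apply Subtype.ext
  change ∫ γ, (γ m : ℝ) ∂(ENNReal.ofReal (1 - (r : ℝ)) • Measure.dirac α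
    + ENNReal.ofReal (r : ℝ) • Measure.dirac β) = (1 - (r : ℝ)) * (α m : ℝ) + (r : ℝ) * (β m : ℝ)
  rw [integral_add_measure ((hint α).smul_measure ENNReal.ofReal_ne_top)
      ((hint β).smul_measure ENNReal.ofReal_ne_top), integral_smul_measure, integral_smul_measure,
    integral_dirac' _ _ hmeas, integral_dirac' _ _ hmeas,
    ENNReal.toReal_ofReal (sub_nonneg.mpr r.2.2), ENNReal.toReal_ofReal r.2.1, smul_eq_mul,
    smul_eq_mul]

lemma eps2_pcomb_dirac_s13 (r : unitInterval) (a b : Bool) :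
    eps2 (pcomb r (dirac a) (dirac b)) = twoComb r a b := by
  have hmass : (pcomb r (dirac a) (dirac b)).toMeasure {true}
      = ENNReal.ofReal (1 - (r : ℝ)) * ({true} : Set Bool).indicator 1 a
        + ENNReal.ofReal (r : ℝ) * ({true} : Set Bool).indicator 1 b := by
    change (ENNReal.ofReal (1 - (r : ℝ)) • Measure.dirac a
      + ENNReal.ofReal (r : ℝ) • Measure.dirac b) {true} = _
    simp
  have hsum : ENNReal.ofReal (1 - (r : ℝ)) + ENNReal.ofReal (r : ℝ) = 1 := by
    rw [← ENNReal.ofReal_add (sub_nonneg.mpr r.2.2) r.2.1]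
    simp
  unfold eps2 twoComb
  rw [hmass]
  by_cases h0 : r = 0
  · cases a <;> simp [h0]
  by_cases h1 : r = 1
  · cases b <;> simp [h1]
  cases a <;> cases b <;> simp [h0, h1, hsum]

end Lemmas

/-- **Lemma 4 (statement 13).** For `M` uncountable, the characteristic function
`χ_{{0̄}} : I^M → 2` of the singleton of the constant zero function is affine (with
respect to the pointwise convex structure on `I^M` and the convex structure of `2`),
but not measurable.  In particular there is an affine map between the convex spaces
induced by the Giry algebras `(I^M, E_M)` and `(2, ε₂)` which is not a morphism of
Giry algebras; hence the functor `Φ` is not full. -/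
theorem chi_zero_affine_not_measurable (M : Type*) [Uncountable M] :
    (∀ (r : unitInterval) (α β : M → unitInterval),
      chi ({fun _ => 0} : Set (M → unitInterval)) (fun m => icomb r (α m) (β m))
        = twoComb r (chi ({fun _ => 0} : Set (M → unitInterval)) α)
            (chi ({fun _ => 0} : Set (M → unitInterval)) β)) ∧
    ¬ Measurable (chi ({fun _ => 0} : Set (M → unitInterval))) ∧
    (∃ g : (M → unitInterval) → Bool,
      (∀ (r : unitInterval) (α β : M → unitInterval),
        g (EM M (pcomb r (dirac α) (dirac β)))
          = eps2 (pcomb r (dirac (g α)) (dirac (g β)))) ∧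
      ¬ ∃ hg : Measurable g,
          ∀ φ : MeasureTheory.ProbabilityMeasure (M → unitInterval),
            g (EM M φ) = eps2 (pushforward g hg φ)) := by
  have hnot : ¬ Measurable (chi ({fun _ => 0} : Set (M → unitInterval))) := fun h =>
    not_measurableSet_singleton_pi _ (measurableSet_of_measurable_chi h)
  refine ⟨chi_zero_icomb, hnot, chi {fun _ => 0}, fun r α β => ?_, fun ⟨hg, _⟩ => hnot hg⟩
  rw [EM_pcomb_dirac, eps2_pcomb_dirac_s13, chi_zero_icomb]

end Paper
end

section
/- Let (X,κ) be a Giry algebra and α, β ∈ X. Then the path map π_{α,β} : [0,1] → X for the induced convex structure, defined by π_{α,β}(r) = κ((1−r)δ_α + r δ_β), is a morphism of Giry algebras from (I,E) to (X,κ): π_{α,β} is measurable and for every probability measure ω on [0,1], κ(G(π_{α,β})(ω)) = π_{α,β}(E(ω)), where E(ω) = ∫ r dω(r) and G(π_{α,β}) is the pushforward along π_{α,β}. -/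
namespace Paper

section Helpers

open MeasureTheory

lemma pcomb_apply {X : Type*} [MeasurableSpace X] (r : unitInterval)
    (φ ψ : ProbabilityMeasure X) (s : Set X) :
    (pcomb r φ ψ).toMeasure s =
      ENNReal.ofReal (1 - (r : ℝ)) * φ.toMeasure s + ENNReal.ofReal (r : ℝ) * ψ.toMeasure s :=
  rfl

lemma join_apply {X : Type*} [MeasurableSpace X]
    (Φ : ProbabilityMeasure (ProbabilityMeasure X)) {s : Set X} (hs : MeasurableSet s) :
    (join Φ).toMeasure s = ∫⁻ ξ, ξ.toMeasure s ∂Φ.toMeasure :=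
  (Measure.join_apply hs).trans
    (lintegral_map (Measure.measurable_coe hs) measurable_toMeasure)

lemma lintegral_pushforward {X Y : Type*} [MeasurableSpace X] [MeasurableSpace Y] {f : X → Y}
    (hf : Measurable f) (φ : ProbabilityMeasure X) {g : Y → ENNReal} (hg : Measurable g) :
    ∫⁻ y, g y ∂(pushforward f hf φ).toMeasure = ∫⁻ x, g (f x) ∂φ.toMeasure :=
  lintegral_map hg hf

lemma measurable_pcomb {X : Type*} [MeasurableSpace X] (φ ψ : ProbabilityMeasure X) :
    Measurable fun r : unitInterval => pcomb r φ ψ := by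
  refine measurable_comap_iff.2 (Measure.measurable_of_measurable_coe _ fun s _ => ?_)
  simp_rw [Function.comp_apply, pcomb_apply]
  fun_prop

lemma lintegral_ofReal_eq_Eop (ω : ProbabilityMeasure unitInterval) :
    ∫⁻ r, ENNReal.ofReal (r : ℝ) ∂ω.toMeasure = ENNReal.ofReal (Eop ω : ℝ) := by
  have hint : Integrable (fun r : unitInterval => (r : ℝ)) ω.toMeasure :=
    Integrable.of_bound (by fun_prop) 1 <| .of_forall fun r => by
      simpa [abs_of_nonneg r.2.1] using r.2.2
  exact (ofReal_integral_eq_lintegral_ofReal hint (.of_forall fun r => r.2.1)).symm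

lemma lintegral_ofReal_one_sub_eq_Eop (ω : ProbabilityMeasure unitInterval) :
    ∫⁻ r, ENNReal.ofReal (1 - (r : ℝ)) ∂ω.toMeasure = ENNReal.ofReal (1 - (Eop ω : ℝ)) := by
  have hsub (r : unitInterval) : ENNReal.ofReal (1 - (r : ℝ)) = 1 - ENNReal.ofReal (r : ℝ) := by
    rw [ENNReal.ofReal_sub _ r.2.1, ENNReal.ofReal_one]
  simp_rw [hsub]
  rw [lintegral_sub (by fun_prop) (by simp [lintegral_ofReal_eq_Eop])
    (.of_forall fun r => ENNReal.ofReal_le_one.2 r.2.2), lintegral_ofReal_eq_Eop]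
  simp

/-- Averaging the segment from `φ` to `ψ` over `ω` gives its point at the mean of `ω`. -/
lemma join_pushforward_pcomb {X : Type*} [MeasurableSpace X] (φ ψ : ProbabilityMeasure X)
    (ω : ProbabilityMeasure unitInterval) :
    join (pushforward (fun r => pcomb r φ ψ) (measurable_pcomb φ ψ) ω) = pcomb (Eop ω) φ ψ := by
  refine Subtype.ext (Measure.ext fun s hs => ?_)
  change (join _).toMeasure s = (pcomb _ _ _).toMeasure s
  have hmeas : Measurable fun ξ : ProbabilityMeasure X => ξ.toMeasure s :=
    (Measure.measurable_coe hs).comp measurable_toMeasure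
  rw [join_apply _ hs, lintegral_pushforward _ _ hmeas]
  simp_rw [pcomb_apply]
  rw [lintegral_add_left (by fun_prop), lintegral_mul_const _ (by fun_prop),
    lintegral_mul_const _ (by fun_prop), lintegral_ofReal_one_sub_eq_Eop,
    lintegral_ofReal_eq_Eop]

lemma pushforward_pushforward {X Y Z : Type*} [MeasurableSpace X] [MeasurableSpace Y]
    [MeasurableSpace Z] {f : X → Y} {g : Y → Z} (hf : Measurable f) (hg : Measurable g)
    (φ : ProbabilityMeasure X) :
    pushforward g hg (pushforward f hf φ) = pushforward (g ∘ f) (hg.comp hf) φ :=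
  Subtype.ext (Measure.map_map hg hf)

end Helpers

/-- **Lemma 5.** For a Giry algebra `(X, κ)` and `α, β ∈ X`, the path
map `π_{α,β} : I → X`, `r ↦ κ((1-r)δ_α + rδ_β)`, of the induced convex structure is a
morphism of Giry algebras `(I, E) → (X, κ)`: it is measurable and
`κ(G(π_{α,β})(ω)) = π_{α,β}(E ω)` for every probability measure `ω` on `I`. -/
theorem pathMap_giry_morphism {X : Type*} [MeasurableSpace X]
    (κ : MeasureTheory.ProbabilityMeasure X → X) (hκ : Measurable κ)
    (hdirac : ∀ x, κ (dirac x) = x)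
    (hjoin : ∀ Φ : MeasureTheory.ProbabilityMeasure (MeasureTheory.ProbabilityMeasure X),
      κ (pushforward κ hκ Φ) = κ (join Φ))
    (α β : X) :
    ∃ hm : Measurable (fun r : unitInterval => κ (pcomb r (dirac α) (dirac β))),
      ∀ ω : MeasureTheory.ProbabilityMeasure unitInterval,
        κ (pushforward (fun r : unitInterval => κ (pcomb r (dirac α) (dirac β))) hm ω)
          = κ (pcomb (Eop ω) (dirac α) (dirac β)) := by
  refine ⟨hκ.comp (measurable_pcomb _ _), fun ω => ?_⟩
  rw [← join_pushforward_pcomb, ← hjoin, pushforward_pushforward]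
  rfl

end Paper
end
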